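/- arXiv:2403.13580 — 2 statements merged into one kernel-verified Lean document; each statement's English description precedes it below -/
import Mathlib

section
/- (Jacobi–Trudi identity, alternant form.) Let N ≥ 1 and let λ = (λ_1 ≥ λ_2 ≥ ⋯ ≥ λ_N ≥ 0) be a partition with at most N parts, padded with zeros. Working in the ring of polynomials in x_1, …, x_N over ℤ, let h_m denote the m-th complete homogeneous symmetric polynomial (with h_0 = 1 and h_m = 0 for m < 0). Then det_{1≤i,j≤N}( h_{λ_i − i + j} ) · det_{1≤i,j≤N}( x_j^{N−i} ) = det_{1≤i,j≤N}( x_j^{λ_i + N − i} ). -/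
open MvPolynomial

/-- The `m`-th complete homogeneous symmetric polynomial indexed by an integer,
with the convention `h_m = 0` for `m < 0`. -/
noncomputable def hsymmInt (N : ℕ) (m : ℤ) : MvPolynomial (Fin N) ℤ :=
  if m < 0 then 0 else hsymm (Fin N) ℤ m.toNat

/-- geometric series -/
noncomputable def jtG (N : ℕ) (i : Fin N) : PowerSeries (MvPolynomial (Fin N) ℤ) :=
  PowerSeries.mk fun n => (X i) ^ n

/-- the product of `1 - x_i t` over `i ≠ j` -/
noncomputable def jtE (N : ℕ) (j : Fin N) : Polynomial (MvPolynomial (Fin N) ℤ) :=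
  ∏ i ∈ Finset.univ.erase j, (1 - Polynomial.C (X i) * Polynomial.X)

theorem jtG_mul (N : ℕ) (i : Fin N) :
    jtG N i * ((1 - Polynomial.C (X i) * Polynomial.X :
      Polynomial (MvPolynomial (Fin N) ℤ)) : PowerSeries (MvPolynomial (Fin N) ℤ)) = 1 := by
  have : ((1 - Polynomial.C (X i) * Polynomial.X :
      Polynomial (MvPolynomial (Fin N) ℤ)) : PowerSeries (MvPolynomial (Fin N) ℤ))
      = 1 - PowerSeries.C (X i) * PowerSeries.X := by
    simp
  rw [this, mul_sub, mul_one, mul_left_comm]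
  ext1 n
  cases n with
  | zero => simp [jtG]
  | succ n => simp [jtG, PowerSeries.coeff_succ_mul_X, PowerSeries.coeff_C_mul,
      PowerSeries.coeff_one, pow_succ']

theorem jt_coeff_prod (N n : ℕ) :
    PowerSeries.coeff n (∏ i : Fin N, jtG N i) = hsymm (Fin N) ℤ n := by
  rw [PowerSeries.coeff_prod, hsymm]
  symm
  refine Finset.sum_bij (fun (s : Sym (Fin N) n) _ => Multiset.toFinsupp s.1) ?_ ?_ ?_ ?_
  · intro s _
    rw [Finset.mem_finsuppAntidiag']
    exact ⟨by simpa [Function.id_def] using (Multiset.toFinsupp_sum_eq s.1).trans s.2, Finset.subset_univ _⟩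
  · intro s _ t _ h
    exact Subtype.ext (Multiset.toFinsupp.injective h)
  · intro f hf
    rw [Finset.mem_finsuppAntidiag'] at hf
    refine ⟨⟨Finsupp.toMultiset f, ?_⟩, Finset.mem_univ _, ?_⟩
    · rw [Finsupp.card_toMultiset]; exact hf.1
    · simp
  · intro s _
    rw [Finset.prod_multiset_map_count]
    simp only [jtG, PowerSeries.coeff_mk, Multiset.toFinsupp_apply]
    refine Finset.prod_subset (Finset.subset_univ _) ?_
    intro i _ hi
    rw [Multiset.mem_toFinset] at hi
    rw [Multiset.count_eq_zero_of_notMem hi, pow_zero]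

theorem jt_prod_mul (N : ℕ) (j : Fin N) :
    (∏ i : Fin N, jtG N i) * (jtE N j : PowerSeries (MvPolynomial (Fin N) ℤ)) = jtG N j := by
  have : (jtE N j : PowerSeries (MvPolynomial (Fin N) ℤ)) = ∏ i ∈ Finset.univ.erase j,
     ((1 - Polynomial.C (X i) * Polynomial.X :
      Polynomial (MvPolynomial (Fin N) ℤ)) : PowerSeries (MvPolynomial (Fin N) ℤ)) := by
    rw [jtE]
    simp only [← Polynomial.coeToPowerSeries.ringHom_apply, map_prod]
  rw [this, ← Finset.mul_prod_erase _ _ (Finset.mem_univ j), mul_assoc,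
    ← Finset.prod_mul_distrib, Finset.prod_congr rfl (fun i _ => jtG_mul N i)]
  simp

theorem jtE_coeff (N : ℕ) (j : Fin N) (k : ℕ) (hk : N ≤ k) : (jtE N j).coeff k = 0 := by
  apply Polynomial.coeff_eq_zero_of_natDegree_lt
  have h1 : (jtE N j).natDegree ≤ ∑ i ∈ Finset.univ.erase j, 1 := by
    refine (Polynomial.natDegree_prod_le _ _).trans (Finset.sum_le_sum fun i _ => ?_)
    compute_degree
  have hj := j.isLt
  simp at h1
  omega

theorem jt_key (N : ℕ) (j : Fin N) (a : ℕ) :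
    ∑ k : Fin N, hsymmInt N ((a : ℤ) - (k : ℕ)) * (jtE N j).coeff k = X j ^ a := by
  have h := congrArg (PowerSeries.coeff a) (jt_prod_mul N j)
  rw [mul_comm, PowerSeries.coeff_mul, Finset.Nat.sum_antidiagonal_eq_sum_range_succ_mk] at h
  simp only [jt_coeff_prod, Polynomial.coeff_coe] at h
  rw [jtG, PowerSeries.coeff_mk] at h
  rw [← h, Fin.sum_univ_eq_sum_range
    (fun k => hsymmInt N ((a : ℤ) - (k : ℕ)) * (jtE N j).coeff k) N]
  trans ∑ k ∈ Finset.range (N + (a + 1)), hsymmInt N ((a : ℤ) - (k : ℕ)) * (jtE N j).coeff k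
  · refine Finset.sum_subset (Finset.range_mono (by omega)) fun k _ hk => ?_
    rw [jtE_coeff N j k (by simpa using hk), mul_zero]
  · symm
    trans ∑ k ∈ Finset.range (a + 1), hsymmInt N ((a : ℤ) - (k : ℕ)) * (jtE N j).coeff k
    · refine Finset.sum_congr rfl fun k hk => ?_
      rw [Finset.mem_range] at hk
      rw [hsymmInt, if_neg (by omega), mul_comm]
      congr 2
      omega
    · refine Finset.sum_subset (Finset.range_mono (by omega)) fun k _ hk => ?_
      rw [Finset.mem_range] at hk
      rw [hsymmInt, if_pos (by omega), zero_mul]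

theorem jt_mul (N : ℕ) (lam : Fin N → ℕ) :
    Matrix.det (fun i j : Fin N => hsymmInt N ((lam i : ℤ) - (i : ℕ) + (j : ℕ)))
        * Matrix.det (fun l j : Fin N => (jtE N j).coeff (Fin.rev l : Fin N))
      = Matrix.det (fun i j : Fin N =>
          (X j : MvPolynomial (Fin N) ℤ) ^ (lam i + (N - 1 - (i : ℕ)))) := by
  refine (Matrix.det_mul _ _).symm.trans ?_
  refine congrArg Matrix.det ?_
  ext1 i
  intro j
  refine Matrix.mul_apply.trans ?_
  rw [← jt_key, ← Equiv.sum_comp Fin.revPerm]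
  refine Finset.sum_congr rfl fun k _ => ?_
  have hi := i.isLt
  have hk := k.isLt
  simp only [Fin.revPerm_apply, Fin.rev_rev]
  congr 2
  rw [Fin.val_rev]
  omega

theorem jt_det_one (N : ℕ) :
    Matrix.det (fun i j : Fin N => hsymmInt N (((0 : ℕ) : ℤ) - (i : ℕ) + (j : ℕ))) = 1 := by
  refine (Matrix.det_of_isUpperTriangular ?_).trans ?_
  rotate_left
  · simp [hsymmInt]
  · intro i j hij
    have : (j : ℕ) < i := hij
    simp only [hsymmInt]
    rw [if_pos (by omega)]

/-- Jacobi–Trudi identity, alternant form: for a partition `λ` with at most `N`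
parts (padded with zeros, indexed here by `Fin N`, so row `i` corresponds to
`λ_{i+1}`), `det(h_{λ_i - i + j}) ⬝ det(x_j^{N-i}) = det(x_j^{λ_i + N - i})`. -/
theorem jacobi_trudi_alternant (N : ℕ) (hN : 1 ≤ N) (lam : Fin N → ℕ)
    (hanti : Antitone lam) :
    Matrix.det (fun i j : Fin N => hsymmInt N ((lam i : ℤ) - (i : ℕ) + (j : ℕ)))
        * Matrix.det (fun i j : Fin N =>
            (X j : MvPolynomial (Fin N) ℤ) ^ (N - 1 - (i : ℕ)))
      = Matrix.det (fun i j : Fin N =>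
          (X j : MvPolynomial (Fin N) ℤ) ^ (lam i + (N - 1 - (i : ℕ)))) := by
  have h := jt_mul N (fun _ => 0)
  rw [jt_det_one, one_mul] at h
  simp only [zero_add] at h
  rw [← h]
  exact jt_mul N lam
end

section
/- (Dual Jacobi–Trudi identity.) Let λ be a partition with ℓ parts λ_1 ≥ ⋯ ≥ λ_ℓ > 0, and let λ' be its transpose, λ'_j = #{ i : λ_i ≥ j }, which has λ_1 parts. Working with symmetric polynomials in N ≥ |λ| variables over ℤ, with h_m the complete homogeneous and e_m the elementary symmetric polynomials (h_0 = e_0 = 1, h_m = e_m = 0 for m < 0, e_m = 0 for m > N), one has det_{1≤i,j≤ℓ}( h_{λ_i − i + j} ) = det_{1≤i,j≤λ_1}( e_{λ'_i − i + j} ). -/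
open MvPolynomial

/-- The `m`-th elementary symmetric polynomial indexed by an integer, with the
conventions `e_m = 0` for `m < 0` (and `e_m = 0` for `m > N`, which holds
automatically for `esymm`). -/
noncomputable def esymmInt (N : ℕ) (m : ℤ) : MvPolynomial (Fin N) ℤ :=
  if m < 0 then 0 else esymm (Fin N) ℤ m.toNat

theorem jt_jacobi {R m n : Type*} [CommRing R] [Fintype m] [Fintype n] [DecidableEq m] [DecidableEq n]
    (A B : Matrix (m ⊕ n) (m ⊕ n) R) (h : A * B = 1) :
    A.toBlocks₁₁.det = A.det * B.toBlocks₂₂.det := by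
  have key : A * Matrix.fromBlocks 1 B.toBlocks₁₂ 0 B.toBlocks₂₂
      = Matrix.fromBlocks A.toBlocks₁₁ 0 A.toBlocks₂₁ 1 := by
    rw [← Matrix.fromBlocks_toBlocks A, ← Matrix.fromBlocks_toBlocks B, Matrix.fromBlocks_multiply,
      ← Matrix.fromBlocks_one, Matrix.fromBlocks_inj] at h
    conv_lhs => rw [← Matrix.fromBlocks_toBlocks A]
    rw [Matrix.fromBlocks_multiply]
    simp [h.2.1, h.2.2.2]
  have := congrArg Matrix.det key
  simpa using this.symm

theorem jt_hgen (N n : ℕ) : PowerSeries.coeff n (∏ i : Fin N, (PowerSeries.mk fun k =>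
    (X i : MvPolynomial (Fin N) ℤ) ^ k)) = hsymm (Fin N) ℤ n := by
  rw [PowerSeries.coeff_prod, hsymm]
  symm
  refine Finset.sum_bij' (fun s _ => Multiset.toFinsupp s.1)
    (fun f hf => ⟨Finsupp.toMultiset f, ?_⟩) ?_ ?_ ?_ ?_ ?_
  · simp only [Finset.mem_finsuppAntidiag] at hf
    rw [Finsupp.card_toMultiset, Finsupp.sum_fintype _ _ (by simp)]
    exact hf.1
  · intro s _
    simp only [Finset.mem_finsuppAntidiag, Finset.subset_univ, and_true]
    have h2 : Multiset.card s.1 = n := s.2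
    have h3 := Finsupp.card_toMultiset (Multiset.toFinsupp s.1)
    rw [Finsupp.sum_fintype _ _ (by simp), Multiset.toFinsupp_toMultiset, h2] at h3
    exact h3.symm
  · intro f hf
    exact Finset.mem_univ _
  · intro s _
    apply Subtype.ext
    simp
  · intro f _
    simp
  · intro s _
    simp [Finset.prod_multiset_map_count]
    refine Finset.prod_subset (Finset.subset_univ _) ?_
    intro x _ hx
    simp at hx
    simp [Multiset.count_eq_zero_of_notMem, hx]

theorem jt_egen (N n : ℕ) : PowerSeries.coeff n (∏ i : Fin N, (1 -
    PowerSeries.C (X i : MvPolynomial (Fin N) ℤ) * PowerSeries.X)) = (-1) ^ n * esymm (Fin N) ℤ n := by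
  simp_rw [sub_eq_add_neg]
  have ht : ∀ t : Finset (Fin N), PowerSeries.coeff n (∏ i ∈ t,
      -(PowerSeries.C (X i : MvPolynomial (Fin N) ℤ) * PowerSeries.X)) =
      if n = t.card then (-1) ^ n * ∏ i ∈ t, X i else 0 := by
    intro t
    have : (∏ i ∈ t, -(PowerSeries.C (X i : MvPolynomial (Fin N) ℤ) * PowerSeries.X)) =
        PowerSeries.C ((-1) ^ t.card * ∏ i ∈ t, X i) * PowerSeries.X ^ t.card := by
      rw [Finset.prod_neg, Finset.prod_mul_distrib, Finset.prod_const, map_mul, map_prod]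
      simp [mul_assoc]
    rw [this, PowerSeries.coeff_C_mul_X_pow]
    split_ifs with h
    · rw [h]
    · rfl
  rw [Finset.prod_one_add, map_sum, esymm, Finset.mul_sum, Finset.sum_congr rfl fun t _ => ht t,
    ← Finset.sum_filter]
  refine Finset.sum_congr ?_ fun _ _ => rfl
  ext t
  simp [Finset.mem_powersetCard, eq_comm]

theorem jt_HE (N : ℕ) : (PowerSeries.mk fun n => hsymm (Fin N) ℤ n) *
   (PowerSeries.mk fun n => (-1) ^ n * esymm (Fin N) ℤ n) = 1 := by
  have h1 : (PowerSeries.mk fun n => hsymm (Fin N) ℤ n) = ∏ i : Fin N, (PowerSeries.mk fun k =>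
    (X i : MvPolynomial (Fin N) ℤ) ^ k) := by
    ext1 n; rw [jt_hgen, PowerSeries.coeff_mk]
  have h2 : (PowerSeries.mk fun n => (-1) ^ n * esymm (Fin N) ℤ n) = ∏ i : Fin N, (1 -
    PowerSeries.C (X i : MvPolynomial (Fin N) ℤ) * PowerSeries.X) := by
    ext1 n; rw [jt_egen, PowerSeries.coeff_mk]
  rw [h1, h2, ← Finset.prod_mul_distrib]
  refine Finset.prod_eq_one fun i _ => ?_
  ext1 n
  cases n with
  | zero => simp
  | succ n =>
    rw [mul_sub, mul_one, map_sub, ← mul_assoc, PowerSeries.coeff_succ_mul_X, mul_comm _ (PowerSeries.C _), PowerSeries.coeff_C_mul]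
    simp [PowerSeries.coeff_one, pow_succ']
noncomputable def jtT {R : Type*} [CommRing R] (n : ℕ) (a : PowerSeries R) : Matrix (Fin n) (Fin n) R :=
  fun i j => if (i : ℕ) ≤ j then PowerSeries.coeff ((j : ℕ) - i) a else 0

theorem jtT_mul {R : Type*} [CommRing R] (n : ℕ) (a b : PowerSeries R) (h : a * b = 1) :
    jtT n a * jtT n b = 1 := by
  ext i j
  rw [Matrix.mul_apply]
  simp only [jtT]
  rw [Fin.sum_univ_eq_sum_range (fun k => (if (i : ℕ) ≤ k then PowerSeries.coeff (k - i) a else 0) *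
    (if k ≤ (j : ℕ) then PowerSeries.coeff ((j : ℕ) - k) b else 0))]
  by_cases hij : (i : ℕ) ≤ j
  · have : (1 : Matrix (Fin n) (Fin n) R) i j = PowerSeries.coeff ((j : ℕ) - i) (a * b) := by
      rw [h, Matrix.one_apply, PowerSeries.coeff_one]
      congr 1
      rw [Fin.ext_iff, eq_iff_iff]; omega
    rw [this, PowerSeries.coeff_mul, Finset.Nat.sum_antidiagonal_eq_sum_range_succ_mk]
    symm
    refine Finset.sum_of_injOn (fun k => k + (i : ℕ)) ?_ ?_ ?_ ?_
    · intro x _ y _ hxy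
      simpa using hxy
    · intro x hx
      have := j.2
      simp at hx ⊢
      omega
    · intro k hk hk2
      by_cases h1 : (i : ℕ) ≤ k
      · by_cases h3 : k ≤ (j : ℕ)
        · exfalso
          apply hk2
          refine ⟨k - i, ?_, ?_⟩
          · simp; omega
          · simp; omega
        · simp [h3]
      · simp [h1]
    · intro k hk
      simp at hk
      rw [if_pos (by omega), if_pos (by omega)]
      congr 3 <;> simp ; omega
  · rw [Matrix.one_apply_ne (by rintro rfl; simp at hij)]
    refine Finset.sum_eq_zero fun k _ => ?_
    by_cases h1 : (i : ℕ) ≤ k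
    · rw [if_neg (by omega : ¬ k ≤ (j : ℕ)), mul_zero]
    · simp [h1]

theorem jtT_det {R : Type*} [CommRing R] (n : ℕ) (a : PowerSeries R) (h : PowerSeries.coeff 0 a = 1) :
    (jtT n a).det = 1 := by
  rw [Matrix.det_of_isUpperTriangular]
  · refine Finset.prod_eq_one fun i _ => ?_
    rw [jtT, if_pos le_rfl, Nat.sub_self, h]
  · intro i j hij
    rw [jtT, if_neg]
    simpa using hij

theorem jt_key_s4 (ℓ : ℕ) (lam : Fin ℓ → ℕ) (hanti : Antitone lam) (j : ℕ) (r : Fin ℓ) :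
    (r : ℕ) < (Finset.univ.filter fun r : Fin ℓ => j + 1 ≤ lam r).card ↔ j < lam r := by
  constructor
  · intro h
    by_contra hc
    have : (Finset.univ.filter fun r : Fin ℓ => j + 1 ≤ lam r) ⊆ Finset.Iio r := by
      intro x hx
      simp at hx ⊢
      by_contra hx2
      have := hanti (not_lt.mp hx2)
      omega
    have := Finset.card_le_card this
    rw [Fin.card_Iio] at this
    omega
  · intro h
    have : Finset.Iic r ⊆ (Finset.univ.filter fun r : Fin ℓ => j + 1 ≤ lam r) := by
      intro x hx
      simp at hx ⊢
      have := hanti hx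
      omega
    have := Finset.card_le_card this
    rw [Fin.card_Iic] at this
    omega

theorem jt_perm (ℓ m : ℕ) (lam : Fin ℓ → ℕ) (c : ℕ → ℕ) (hanti : Antitone lam)
    (hm : ∀ i, lam i ≤ m) (hc : ∀ j, c j = (Finset.univ.filter fun r : Fin ℓ => j + 1 ≤ lam r).card) :
    ∃ π : Equiv.Perm (Fin (ℓ + m)), (∀ p : Fin ℓ, (π (Fin.castAdd m p) : ℕ) = lam p.rev + p) ∧
      (∀ j : Fin m, (π (Fin.natAdd ℓ j) : ℕ) = ℓ + j - c j) ∧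
      Equiv.Perm.sign π = ∏ j : Fin m, (-1) ^ c j := by
  have hcl : ∀ j, c j ≤ ℓ := by
    intro j; rw [hc]; exact (Finset.card_le_univ _).trans (by simp)
  have hca : Antitone c := by
    intro a b hab
    rw [hc, hc]
    refine Finset.card_le_card fun x hx => ?_
    simp at hx ⊢
    omega
  have key : ∀ j (r : Fin ℓ), (r : ℕ) < c j ↔ j < lam r := fun j r => by
    rw [hc]; exact jt_key_s4 ℓ lam hanti j r
  let f : Fin (ℓ + m) → Fin (ℓ + m) := Fin.addCases
    (fun p => ⟨lam p.rev + p, by have := hm p.rev; have := p.2; omega⟩)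
    (fun j => ⟨ℓ + j - c j, by have := j.2; omega⟩)
  have f1 : ∀ p : Fin ℓ, (f (Fin.castAdd m p) : ℕ) = lam p.rev + p := fun p => by simp [f]
  have f2 : ∀ j : Fin m, (f (Fin.natAdd ℓ j) : ℕ) = ℓ + j - c j := fun j => by simp [f]
  have m1 : ∀ p q : Fin ℓ, p < q → f (Fin.castAdd m p) < f (Fin.castAdd m q) := by
    intro p q h
    rw [Fin.lt_def, f1, f1]
    have := hanti (Fin.rev_le_rev.mpr h.le)
    rw [Fin.lt_def] at h
    omega
  have m2 : ∀ p q : Fin m, p < q → f (Fin.natAdd ℓ p) < f (Fin.natAdd ℓ q) := by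
    intro p q h
    rw [Fin.lt_def, f2, f2]
    have h1 := hca (Fin.le_def.mp h.le)
    have h2 := hcl p
    rw [Fin.lt_def] at h
    omega
  have m3 : ∀ (p : Fin ℓ) (j : Fin m), (f (Fin.castAdd m p) < f (Fin.natAdd ℓ j) ↔
      ¬ ((j : ℕ) + 1 ≤ lam p.rev)) ∧ f (Fin.castAdd m p) ≠ f (Fin.natAdd ℓ j) := by
    intro p j
    rw [Fin.lt_def, Ne, Fin.ext_iff, f1, f2]
    have h1 := key j p.rev
    have h2 := hcl j
    have h3 := p.2
    rw [Fin.val_rev] at h1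
    omega
  have finj : Function.Injective f := by
    intro a b
    induction a using Fin.addCases with
    | left p =>
      induction b using Fin.addCases with
      | left q =>
        intro h
        rcases lt_trichotomy p q with h' | h' | h'
        · exact absurd h (m1 _ _ h').ne
        · rw [h']
        · exact absurd h (m1 _ _ h').ne'
      | right q => intro h; exact absurd h (m3 p q).2
    | right p =>
      induction b using Fin.addCases with
      | left q => intro h; exact absurd h.symm (m3 q p).2
      | right q =>
        intro h
        rcases lt_trichotomy p q with h' | h' | h'
        · exact absurd h (m2 _ _ h').ne
        · rw [h']
        · exact absurd h (m2 _ _ h').ne'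
  refine ⟨Equiv.ofBijective f (Finite.injective_iff_bijective.mp finj), f1, f2, ?_⟩
  rw [Equiv.Perm.sign_eq_prod_prod_Ioi]
  have : ∀ i : Fin (ℓ + m), Finset.Ioi i = Finset.univ.filter fun j => i < j := by
    intro i; ext; simp
  simp only [this, Finset.prod_filter, Equiv.ofBijective_apply, Fin.prod_univ_add]
  have e1 : ∀ p q : Fin ℓ, (if Fin.castAdd m p < Fin.castAdd m q then
      (if f (Fin.castAdd m p) < f (Fin.castAdd m q) then (1 : ℤˣ) else -1) else 1) = 1 := by
    intro p q
    split_ifs with h h'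
    · rfl
    · exact absurd (m1 p q h) h'
    · rfl
  have e2 : ∀ p q : Fin m, (if Fin.natAdd ℓ p < Fin.natAdd ℓ q then
      (if f (Fin.natAdd ℓ p) < f (Fin.natAdd ℓ q) then (1 : ℤˣ) else -1) else 1) = 1 := by
    intro p q
    split_ifs with h h'
    · rfl
    · exact absurd (m2 p q (by simpa using h)) h'
    · rfl
  have e3 : ∀ (p : Fin m) (q : Fin ℓ), (if Fin.natAdd ℓ p < Fin.castAdd m q then
      (if f (Fin.natAdd ℓ p) < f (Fin.castAdd m q) then (1 : ℤˣ) else -1) else 1) = 1 := by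
    intro p q
    rw [if_neg]
    rw [Fin.lt_def]; simp; omega
  have e4 : ∀ (p : Fin ℓ) (q : Fin m), (if Fin.castAdd m p < Fin.natAdd ℓ q then
      (if f (Fin.castAdd m p) < f (Fin.natAdd ℓ q) then (1 : ℤˣ) else -1) else 1) =
      if (q : ℕ) + 1 ≤ lam p.rev then -1 else 1 := by
    intro p q
    rw [if_pos (by rw [Fin.lt_def]; simp; omega)]
    simp only [(m3 p q).1, ite_not]
  simp only [e1, e2, e3, e4, Finset.prod_const_one, one_mul, mul_one]
  rw [Finset.prod_comm]
  refine Finset.prod_congr rfl fun j _ => ?_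
  rw [hc, ← Finset.prod_const, Finset.prod_filter]
  exact Equiv.prod_comp Fin.revPerm (fun p => if (j : ℕ) + 1 ≤ lam p then (-1 : ℤˣ) else 1)


theorem jt_h (N n : ℕ) (i j : Fin n) : jtT n (PowerSeries.mk fun n => hsymm (Fin N) ℤ n) i j =
    hsymmInt N ((j : ℕ) - (i : ℕ)) := by
  rw [jtT, hsymmInt, PowerSeries.coeff_mk]
  by_cases h : (i : ℕ) ≤ j
  · rw [if_pos h, if_neg (by omega)]
    congr 1
    omega
  · rw [if_neg h, if_pos (by omega)]

theorem jt_e (N n : ℕ) (i j : Fin n) :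
    jtT n (PowerSeries.mk fun n => (-1) ^ n * esymm (Fin N) ℤ n) i j =
    (-1) ^ ((j : ℕ) + i) * esymmInt N ((j : ℕ) - (i : ℕ)) := by
  rw [jtT, esymmInt, PowerSeries.coeff_mk]
  by_cases h : (i : ℕ) ≤ j
  · rw [if_pos h, if_neg (by omega)]
    rw [show (j : ℕ) + i = (j - i) + 2 * i by omega, pow_add _ _ (2 * _), pow_mul]
    rw [show (((j : ℕ) : ℤ) - (i : ℕ)).toNat = (j : ℕ) - i by omega]
    simp
  · rw [if_neg h, if_pos (by omega), mul_zero]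

/-- Dual Jacobi–Trudi identity: for a partition `λ` with `ℓ` positive parts
(indexed here by `Fin ℓ`, row `i` corresponding to `λ_{i+1}`) and transpose
`λ'_j = #{i : λ_i ≥ j}` (which has `λ_1` parts), working in `N ≥ |λ|` variables,
`det_{1≤i,j≤ℓ}(h_{λ_i - i + j}) = det_{1≤i,j≤λ_1}(e_{λ'_i - i + j})`. -/
theorem jacobi_trudi_dual (ℓ N : ℕ) (hℓ : 0 < ℓ) (lam : Fin ℓ → ℕ)
    (hanti : Antitone lam) (hpos : ∀ i, 0 < lam i) (hN : ∑ i, lam i ≤ N) :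
    Matrix.det (fun i j : Fin ℓ => hsymmInt N ((lam i : ℤ) - (i : ℕ) + (j : ℕ)))
      = Matrix.det (fun i j : Fin (lam ⟨0, hℓ⟩) =>
          esymmInt N
            ((((Finset.univ.filter fun r : Fin ℓ => (i : ℕ) + 1 ≤ lam r).card : ℤ))
              - (i : ℕ) + (j : ℕ))) := by
  
  have hm : ∀ i, lam i ≤ lam ⟨0, hℓ⟩ := fun i => hanti (Fin.le_def.mpr (Nat.zero_le _))
  generalize lam ⟨0, hℓ⟩ = m at hm
  let c : ℕ → ℕ := fun j => (Finset.univ.filter fun r : Fin ℓ => j + 1 ≤ lam r).card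
  have hcl : ∀ j, c j ≤ ℓ := fun j => (Finset.card_le_univ _).trans (by simp)
  obtain ⟨π, h1, h2, h3⟩ := jt_perm ℓ m lam c hanti hm (fun _ => rfl)
  let H := jtT (ℓ + m) (PowerSeries.mk fun n => hsymm (Fin N) ℤ n)
  let E := jtT (ℓ + m) (PowerSeries.mk fun n => (-1) ^ n * esymm (Fin N) ℤ n)
  have hHE : H * E = 1 := jtT_mul _ _ _ (jt_HE N)
  let s : Fin ℓ ⊕ Fin m ≃ Fin (ℓ + m) := finSumFinEquiv
  let A := (H.submatrix id π).submatrix s s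
  let B := (E.submatrix π id).submatrix s s
  have hAB : A * B = 1 := by
    simp only [A, B]
    rw [Matrix.submatrix_mul_equiv, Matrix.submatrix_mul_equiv, hHE]
    simp
  have hJ := jt_jacobi A B hAB
  have hA : A.det = ((∏ j : Fin m, (-1) ^ c j : ℤˣ) : ℤ) := by
    simp only [A]
    rw [Matrix.det_submatrix_equiv_self, Matrix.det_permute', h3, jtT_det _ _ (by simp), mul_one]
  have hL : A.toBlocks₁₁.det =
      Matrix.det (fun i j : Fin ℓ => hsymmInt N ((lam i : ℤ) - (i : ℕ) + (j : ℕ))) := by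
    rw [← Matrix.det_transpose, ← Matrix.det_submatrix_equiv_self Fin.revPerm]
    congr 1
    ext1 i j
    have e : A.toBlocks₁₁ (Fin.rev j) (Fin.rev i) =
        H (Fin.castAdd m j.rev) (π (Fin.castAdd m i.rev)) := by
      simp [A, s, Matrix.toBlocks₁₁]
    change A.toBlocks₁₁ (Fin.rev j) (Fin.rev i) = _
    rw [e, show H _ _ = _ from jt_h N _ _ _, h1, Fin.rev_rev, Fin.val_castAdd, Fin.val_rev, Fin.val_rev]
    congr 1
    omega
  let F : Matrix (Fin m) (Fin m) (MvPolynomial (Fin N) ℤ) :=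
    fun i j => esymmInt N ((c i : ℤ) - (i : ℕ) + (j : ℕ))
  change _ = F.det
  have hR : B.toBlocks₂₂ = Matrix.of fun i j : Fin m => (-1) ^ (c i + i) *
      (Matrix.of fun i j : Fin m => (-1) ^ (j : ℕ) *
        F i j) i j := by
    ext1 i j
    have e : B.toBlocks₂₂ i j = E (π (Fin.natAdd ℓ i)) (Fin.natAdd ℓ j) := by
      simp [B, s, Matrix.toBlocks₂₂]
    have hci := hcl i
    rw [e, show E _ _ = _ from jt_e N _ _ _, h2, Fin.val_natAdd]
    simp only [Matrix.of_apply, F]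
    rw [← mul_assoc, ← pow_add]
    have e2 : ((ℓ + j : ℕ) : ℤ) - ((ℓ + i - c i : ℕ) : ℤ) = (c i : ℤ) - (i : ℕ) + (j : ℕ) := by
      omega
    rw [e2]
    congr 1
    rw [show ℓ + (j : ℕ) + (ℓ + i - c i) = c i + i + j + 2 * (ℓ - c i) by omega, pow_add _ _ (2 * _),
      pow_mul]
    simp
  rw [← hL, hJ, hA, hR, Matrix.det_mul_column, Matrix.det_mul_row]
  rw [← mul_assoc, ← mul_assoc]
  have hs : ((((∏ j : Fin m, (-1) ^ c j : ℤˣ) : ℤ) : MvPolynomial (Fin N) ℤ) *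
      ∏ i : Fin m, (-1) ^ (c i + i)) * ∏ i : Fin m, (-1) ^ (i : ℕ) = 1 := by
    push_cast
    rw [← Finset.prod_mul_distrib, ← Finset.prod_mul_distrib]
    refine Finset.prod_eq_one fun i _ => ?_
    rw [← pow_add, ← pow_add]
    exact Even.neg_one_pow ⟨c i + i, by ring⟩
  rw [hs, one_mul]
end
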